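/- Assume that for every prime ideal p of A, the largest invariant ideal p* = {x ∈ p : ψ(x) ∈ p ⊗ H} contained in p is again a prime ideal. Then the intersection of any two quasi-compact open subsets of Spec^inv(A) is again quasi-compact. -/

import Mathlib

open TensorProduct

variable (k : Type*) [Field k]
variable (A : Type*) [CommRing A] [Algebra k A]
variable (H : Type*) [Ring H] [HopfAlgebra k H]

/-- The image `I ⊗ H` of the canonical map `I ⊗[k] H → A ⊗[k] H`, for an ideal `I` of `A`. -/
noncomputable def idealTensor (I : Ideal A) : Submodule k (A ⊗[k] H) :=
  LinearMap.range (TensorProduct.map ((I.restrictScalars k).subtype)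
    (LinearMap.id : H →ₗ[k] H))

/-- An ideal `I` of `A` is invariant (for the coaction `ψ : A → A ⊗[k] H`) if
`ψ x ∈ I ⊗ H` for all `x ∈ I`. -/
def IsInvariantIdeal (ψ : A →ₐ[k] A ⊗[k] H) (I : Ideal A) : Prop :=
  ∀ x ∈ I, ψ x ∈ idealTensor k A H I

/-- Coassociativity of the coaction `ψ`:
`(ψ ⊗ id_H) ∘ ψ = (id_A ⊗ Δ_H) ∘ ψ` as maps `A → A ⊗[k] H ⊗[k] H`. -/
def IsCoassoc (ψ : A →ₐ[k] A ⊗[k] H) : Prop :=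
  ∀ a : A,
    (TensorProduct.assoc k A H H)
        ((TensorProduct.map ψ.toLinearMap (LinearMap.id : H →ₗ[k] H)) (ψ a))
      = (TensorProduct.map (LinearMap.id : A →ₗ[k] A)
          (Coalgebra.comul (R := k) (A := H))) (ψ a)

/-- Counitality of the coaction `ψ`: `(id_A ⊗ ε_H) ∘ ψ = id_A` under the canonical
isomorphism `A ⊗[k] k ≅ A`. -/
def IsCounital (ψ : A →ₐ[k] A ⊗[k] H) : Prop :=
  ∀ a : A,
    (TensorProduct.rid k A)
        ((TensorProduct.map (LinearMap.id : A →ₗ[k] A)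
          (Coalgebra.counit (R := k) (A := H))) (ψ a)) = a

/-- The set `I* = {x ∈ I : ψ x ∈ I ⊗ H}`. -/
def starSet (ψ : A →ₐ[k] A ⊗[k] H) (I : Ideal A) : Set A :=
  {x : A | x ∈ I ∧ ψ x ∈ idealTensor k A H I}

section Aux

variable {k A H}

/-- The slice map `id ⊗ φ : A ⊗ H → A`. -/
noncomputable def sliceMap (φ : H →ₗ[k] k) : A ⊗[k] H →ₗ[k] A :=
  (TensorProduct.rid k A).toLinearMap ∘ₗ φ.lTensor A

/-- The slice map `id ⊗ φ : H ⊗ H → H`. -/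
noncomputable def sliceMapH (φ : H →ₗ[k] k) : H ⊗[k] H →ₗ[k] H :=
  (TensorProduct.rid k H).toLinearMap ∘ₗ φ.lTensor H

lemma sliceMap_tmul (φ : H →ₗ[k] k) (a : A) (h : H) :
    sliceMap φ (a ⊗ₜ[k] h) = φ h • a := by
  simp [sliceMap]

lemma map_mem_idealTensor (I : Ideal A) (g : H →ₗ[k] H) (t : A ⊗[k] H)
    (ht : t ∈ idealTensor k A H I) : g.lTensor A t ∈ idealTensor k A H I := by
  obtain ⟨s, rfl⟩ := ht
  refine ⟨g.lTensor _ s, ?_⟩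
  induction s with
  | zero => simp
  | tmul x y => simp
  | add x y hx hy => simp only [map_add, hx, hy]

lemma slice_mem (I : Ideal A) (φ : H →ₗ[k] k) (t : A ⊗[k] H)
    (ht : t ∈ idealTensor k A H I) : sliceMap φ t ∈ I := by
  obtain ⟨s, rfl⟩ := ht
  induction s with
  | zero => simp
  | tmul x y =>
    rw [TensorProduct.map_tmul, sliceMap_tmul]
    exact (I.restrictScalars k).smul_mem _ x.2
  | add x y hx hy => rw [map_add, map_add]; exact I.add_mem hx hy

lemma mem_idealTensor_iff {ι : Type*} (b : Module.Basis ι k H) (I : Ideal A) (t : A ⊗[k] H) :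
    t ∈ idealTensor k A H I ↔ ∀ i, sliceMap (b.coord i) t ∈ I := by
  classical
  refine ⟨fun h i => slice_mem I _ t h, fun h => ?_⟩
  rw [← (TensorProduct.equivFinsuppOfBasisRight b).symm_apply_apply t,
    TensorProduct.equivFinsuppOfBasisRight_symm_apply]
  refine Submodule.sum_mem _ fun i _ => ?_
  have hi := h i
  rw [show sliceMap (b.coord i) t = TensorProduct.equivFinsuppOfBasisRight b t i from
    (TensorProduct.equivFinsuppOfBasisRight_apply b t i).symm] at hi
  exact ⟨(⟨_, hi⟩ : I.restrictScalars k) ⊗ₜ b i, by simp⟩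

lemma psi_slice (ψ : A →ₐ[k] A ⊗[k] H) (hco : IsCoassoc k A H ψ) (φ : H →ₗ[k] k) (a : A) :
    ψ (sliceMap φ (ψ a)) =
      LinearMap.lTensor A (sliceMapH φ ∘ₗ Coalgebra.comul (R := k) (A := H)) (ψ a) := by
  have h := congrArg (LinearMap.lTensor A (sliceMapH φ)) (hco a)
  have h1 : ∀ t : A ⊗[k] H, LinearMap.lTensor A (sliceMapH φ)
      ((TensorProduct.assoc k A H H)
        ((TensorProduct.map ψ.toLinearMap (LinearMap.id : H →ₗ[k] H)) t)) =
        ψ (sliceMap φ t) := by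
    intro t
    induction t with
    | zero => simp
    | add x y hx hy => simp only [map_add, hx, hy]
    | tmul x y =>
      rw [TensorProduct.map_tmul, sliceMap_tmul, map_smul]
      change _ = φ y • ψ.toLinearMap x
      generalize ψ.toLinearMap x = s
      induction s with
      | zero => simp
      | add u v hu hv => simp only [TensorProduct.add_tmul, map_add, smul_add, hu, hv]
      | tmul u v => simp [sliceMapH]
  rw [h1] at h
  rw [h, LinearMap.lTensor_comp]
  rfl

lemma star_invariant (ψ : A →ₐ[k] A ⊗[k] H) (hco : IsCoassoc k A H ψ) (p q : Ideal A)
    (hq : (q : Set A) = starSet k A H ψ p) : IsInvariantIdeal k A H ψ q := by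
  intro x hx
  have hx' : x ∈ starSet k A H ψ p := hq ▸ hx
  rw [mem_idealTensor_iff (Module.Basis.ofVectorSpace k H)]
  intro i
  rw [← SetLike.mem_coe, hq]
  refine ⟨slice_mem _ _ _ hx'.2, ?_⟩
  rw [psi_slice ψ hco]
  exact map_mem_idealTensor _ _ _ hx'.2

end Aux

/-- assuming `p*` is prime for every prime `p`, the intersection of any
two quasi-compact open subsets of `Spec^inv(A)` is quasi-compact. -/
theorem stmt14 (ψ : A →ₐ[k] A ⊗[k] H)
    (hco : IsCoassoc k A H ψ) (hcu : IsCounital k A H ψ)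
    (hstar : ∀ p : Ideal A, p.IsPrime →
      ∃ q : Ideal A, (q : Set A) = starSet k A H ψ p ∧ q.IsPrime)
    (U V : Set {q : PrimeSpectrum A // IsInvariantIdeal k A H ψ q.asIdeal})
    (hUo : IsOpen U) (hUc : IsCompact U) (hVo : IsOpen V) (hVc : IsCompact V) :
    IsCompact (U ∩ V) := by
  classical
  let b := Module.Basis.ofVectorSpace k H
  choose r hr hrp using hstar
  let X := {q : PrimeSpectrum A // IsInvariantIdeal k A H ψ q.asIdeal}
  let R : PrimeSpectrum A → X := fun p =>
    ⟨⟨r p.asIdeal p.isPrime, hrp _ _⟩, star_invariant ψ hco _ _ (hr _ _)⟩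
  have hRsurj : Function.Surjective R := by
    intro q
    refine ⟨q.1, Subtype.ext (PrimeSpectrum.ext (SetLike.coe_injective ?_))⟩
    change (r q.1.asIdeal q.1.isPrime : Set A) = _
    rw [hr]
    ext x
    exact ⟨fun h => h.1, fun h => ⟨h, q.2 x h⟩⟩
  let D : A → Set X := fun f => Subtype.val ⁻¹' (PrimeSpectrum.basicOpen f : Set (PrimeSpectrum A))
  have hbasis : TopologicalSpace.IsTopologicalBasis (Set.range D) := by
    have := (PrimeSpectrum.isTopologicalBasis_basic_opens (R := A)).induced
      (Subtype.val : X → PrimeSpectrum A)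
    rw [← Set.range_comp] at this
    exact this
  have hpre : ∀ f, R ⁻¹' (D f) = (PrimeSpectrum.basicOpen f : Set (PrimeSpectrum A)) ∪
      ⋃ i ∈ (TensorProduct.equivFinsuppOfBasisRight b (ψ f)).support,
        (PrimeSpectrum.basicOpen (sliceMap (b.coord i) (ψ f)) : Set (PrimeSpectrum A)) := by
    intro f
    ext p
    have h1 : p ∈ R ⁻¹' (D f) ↔ f ∉ (r p.asIdeal p.isPrime : Set A) := Iff.rfl
    have hs : ∀ i, sliceMap (b.coord i) (ψ f) = TensorProduct.equivFinsuppOfBasisRight b (ψ f) i :=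
      fun i => (TensorProduct.equivFinsuppOfBasisRight_apply b (ψ f) i).symm
    rw [h1, hr]
    simp only [starSet, Set.mem_ofPred_eq, mem_idealTensor_iff b, Set.mem_union, Set.mem_iUnion,
      SetLike.mem_coe, PrimeSpectrum.mem_basicOpen, not_and_or, not_forall]
    refine or_congr Iff.rfl ⟨?_, ?_⟩
    · rintro ⟨i, hi⟩
      refine ⟨i, ?_, hi⟩
      rw [Finsupp.mem_support_iff, ← hs]
      intro h0
      exact hi (h0 ▸ p.asIdeal.zero_mem)
    · rintro ⟨i, _, hi⟩
      exact ⟨i, hi⟩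
  have hRcont : Continuous R := by
    refine hbasis.continuous_iff.2 ?_
    rintro _ ⟨f, rfl⟩
    rw [hpre]
    exact (PrimeSpectrum.basicOpen f).2.union
      (isOpen_biUnion fun i _ => (PrimeSpectrum.basicOpen _).2)
  have hDc : ∀ f, IsCompact (D f) := by
    intro f
    rw [← Set.image_preimage_eq (D f) hRsurj]
    refine IsCompact.image ?_ hRcont
    rw [hpre]
    exact (PrimeSpectrum.isCompact_basicOpen f).union
      (Finset.isCompact_biUnion _ fun i _ => PrimeSpectrum.isCompact_basicOpen _)
  have aux := isCompact_open_iff_eq_finite_iUnion_of_isTopologicalBasis D hbasis hDc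
  obtain ⟨s, hs, rfl⟩ := (aux _).1 ⟨hUc, hUo⟩
  obtain ⟨t, ht, rfl⟩ := (aux _).1 ⟨hVc, hVo⟩
  rw [Set.iUnion₂_inter_iUnion₂]
  refine hs.isCompact_biUnion fun i _ => ht.isCompact_biUnion fun j _ => ?_
  have : D i ∩ D j = D (i * j) := by
    simp only [D, PrimeSpectrum.basicOpen_mul, TopologicalSpace.Opens.coe_inf, Set.preimage_inter]
  rw [this]
  exact hDc _
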